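/- arXiv:2605.19904 — 3 statements merged into one kernel-verified Lean document; each statement's English description precedes it below -/
import Mathlib

section
/- For all integers n ≥ 0, k ≥ 0, and j ≥ 0, one has ∑_{i=0}^{n} e^k_{n,i} · C(n+j−i, n) = (j+k+1)^n, where C(n+j−i, n) is the binomial coefficient. -/
/-- The extended Eulerian numbers `e^k_{n,i}`: `e^k_{0,0} = 1`, `e^k_{n,i} = 0` whenever
`i < 0` or `i > n`, and otherwise
`e^k_{n,i} = (k+i+1)·e^k_{n-1,i} + (n-k-i)·e^k_{n-1,i-1}`. -/
def eulk (k : ℕ) : ℕ → ℕ → ℤ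
  | 0, 0 => 1
  | 0, _ + 1 => 0
  | n + 1, 0 => ((k : ℤ) + 1) * eulk k n 0
  | n + 1, i + 1 =>
    if i + 1 > n + 1 then 0
    else ((k : ℤ) + (i + 1) + 1) * eulk k n (i + 1) + ((n : ℤ) - k - i) * eulk k n i

theorem eulk_eq_zero_of_lt (k : ℕ) {n i : ℕ} (h : n < i) : eulk k n i = 0 := by
  cases n <;> cases i
  · omega
  · simp [eulk]
  · omega
  · simp only [eulk]
    rw [if_pos (by omega)]

theorem eulk_succ_zero (k n : ℕ) : eulk k (n + 1) 0 = ((k : ℤ) + 1) * eulk k n 0 := by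
  simp [eulk]

theorem eulk_succ_succ (k n i : ℕ) :
    eulk k (n + 1) (i + 1) =
      ((k : ℤ) + (i + 1) + 1) * eulk k n (i + 1) + ((n : ℤ) - k - i) * eulk k n i := by
  rcases le_or_gt i n with h | h
  · simp only [eulk]
    rw [if_neg (by omega)]
  · rw [eulk_eq_zero_of_lt k (by omega : n + 1 < i + 1), eulk_eq_zero_of_lt k h,
      eulk_eq_zero_of_lt k (by omega : n < i + 1)]
    ring

/-- Summing the recurrence of the extended Eulerian numbers against arbitrary weights. -/
theorem sum_eulk_succ_mul (k n : ℕ) (f : ℕ → ℤ) :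
    ∑ i ∈ Finset.range (n + 2), eulk k (n + 1) i * f i =
      ∑ i ∈ Finset.range (n + 1),
        eulk k n i * (((k : ℤ) + i + 1) * f i + ((n : ℤ) - k - i) * f (i + 1)) := by
  have shift : ∑ i ∈ Finset.range (n + 1),
        ((k : ℤ) + (i + 1 : ℕ) + 1) * eulk k n (i + 1) * f (i + 1) +
        ((k : ℤ) + (0 : ℕ) + 1) * eulk k n 0 * f 0 =
      ∑ i ∈ Finset.range (n + 1), ((k : ℤ) + i + 1) * eulk k n i * f i := by
    rw [← Finset.sum_range_succ' (fun i : ℕ => ((k : ℤ) + i + 1) * eulk k n i * f i),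
      Finset.sum_range_succ, eulk_eq_zero_of_lt k (Nat.lt_succ_self n)]
    simp
  have rhs : ∑ i ∈ Finset.range (n + 1),
        eulk k n i * (((k : ℤ) + i + 1) * f i + ((n : ℤ) - k - i) * f (i + 1)) =
      ∑ i ∈ Finset.range (n + 1), ((k : ℤ) + i + 1) * eulk k n i * f i +
        ∑ i ∈ Finset.range (n + 1), ((n : ℤ) - k - i) * eulk k n i * f (i + 1) := by
    rw [← Finset.sum_add_distrib]
    exact Finset.sum_congr rfl fun i _ => by ring
  rw [rhs, ← shift, Finset.sum_range_succ', eulk_succ_zero]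
  simp only [eulk_succ_succ, add_mul _ _ (f _), Finset.sum_add_distrib]
  push_cast
  ring

theorem Nat.cast_choose_succ_right_mul (m n : ℕ) :
    ((n : ℤ) + 1) * (m.choose (n + 1) : ℤ) = ((m : ℤ) - n) * (m.choose n : ℤ) := by
  rcases le_or_gt n m with h | h
  · have := Nat.choose_succ_right_eq m n
    zify [h] at this
    linarith
  · simp [Nat.choose_eq_zero_of_lt h, Nat.choose_eq_zero_of_lt (by omega : m < n + 1)]

/-- Worpitzky-type identity: `∑_{i=0}^n e^k_{n,i} C(n+j-i, n) = (j+k+1)^n`. -/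
theorem stmt_3 (n k j : ℕ) :
    ∑ i ∈ Finset.range (n + 1), eulk k n i * ((n + j - i).choose n : ℤ) =
      ((j : ℤ) + k + 1) ^ n := by
  induction n with
  | zero => simp [eulk]
  | succ n ih =>
    rw [sum_eulk_succ_mul k n fun i => ((n + 1 + j - i).choose (n + 1) : ℤ), pow_succ, ← ih,
      Finset.sum_mul]
    refine Finset.sum_congr rfl fun i hi => ?_
    have hin : i ≤ n := by simpa [Nat.lt_succ_iff] using hi
    obtain ⟨m, hm⟩ : ∃ m, n + j = m + i := ⟨n + j - i, by omega⟩
    have hm' : (n : ℤ) + j = m + i := by exact_mod_cast hm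
    rw [show n + 1 + j - i = m + 1 by omega, show n + 1 + j - (i + 1) = m by omega,
      show n + j - i = m by omega, Nat.choose_succ_succ' m n]
    push_cast
    linear_combination eulk k n i * Nat.cast_choose_succ_right_mul m n -
      eulk k n i * (m.choose n : ℤ) * hm'
end

section
/- Let k ≥ 1 and let S = H^k T (a run of k heads followed by one tails). Then E(Y^2) = 2 / ((1−p)^2 p^{2k}) − (2k+1) / ((1−p) p^k). -/
/-- The probability of a given sequence of coin flips, where `true` stands for heads
(probability `p`) and `false` for tails (probability `1 - p`). -/
def coinP (p : ℝ) (w : List Bool) : ℝ := (w.map fun b => if b then p else 1 - p).prod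

/-- The number of occurrences of `S` as a factor (consecutive substring) of `w`. -/
def numOccs (S w : List Bool) : ℕ :=
  ((Finset.range (w.length + 1)).filter fun i => (w.drop i).take S.length = S).card

/-- `coinZ S` is the set of finite binary strings in which `S` occurs exactly once as a
factor, namely as a suffix. -/
def coinZ (S : List Bool) : Set (List Bool) := {w | S <:+ w ∧ numOccs S w = 1}

/-- The `n`-th moment `E(Y^n) = ∑_{w ∈ Z(S)} |w|^n P(w)` of the number of coin flips
needed to produce `S`. -/
noncomputable def coinE (p : ℝ) (S : List Bool) (n : ℕ) : ℝ :=
  ∑' w : coinZ S, (w.1.length : ℝ) ^ n * coinP p w.1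

open Finset

/-- The binary words of length `n`. -/
def binWords : ℕ → Finset (List Bool)
  | 0 => {[]}
  | n + 1 => (binWords n).image (· ++ [true]) ∪ (binWords n).image (· ++ [false])

theorem mem_binWords {n : ℕ} {w : List Bool} : w ∈ binWords n ↔ w.length = n := by
  induction n generalizing w with
  | zero => simp [binWords]
  | succ n ih =>
    simp only [binWords, mem_union, mem_image, ih]
    constructor
    · rintro (⟨u, hu, rfl⟩ | ⟨u, hu, rfl⟩) <;> simp [hu]
    · intro h
      rcases List.eq_nil_or_concat w with rfl | ⟨u, b, rfl⟩
      · simp at h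
      · cases b
        · exact Or.inr ⟨u, by simpa using h, by simp⟩
        · exact Or.inl ⟨u, by simpa using h, by simp⟩

theorem sum_binWords_succ (n : ℕ) (f : List Bool → ℝ) :
    ∑ w ∈ binWords (n + 1), f w =
      ∑ u ∈ binWords n, (f (u ++ [true]) + f (u ++ [false])) := by
  rw [binWords, sum_union, sum_image, sum_image, sum_add_distrib]
  · intro x _ y _ h
    simpa using h
  · intro x _ y _ h
    simpa using h
  · rw [disjoint_left]
    intro x hx hy
    obtain ⟨u, -, rfl⟩ := mem_image.1 hx
    obtain ⟨v, -, hv⟩ := mem_image.1 hy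
    have := (List.append_inj' hv rfl).2
    simp at this

theorem coinP_append (p : ℝ) (u v : List Bool) : coinP p (u ++ v) = coinP p u * coinP p v := by
  simp [coinP]

theorem coinP_nonneg {p : ℝ} (hp : 0 ≤ p) (hp1 : p ≤ 1) (w : List Bool) : 0 ≤ coinP p w := by
  refine List.prod_nonneg ?_
  intro a ha
  obtain ⟨b, -, rfl⟩ := List.mem_map.1 ha
  split_ifs <;> linarith

theorem coinP_run (p : ℝ) (k : ℕ) :
    coinP p (List.replicate k true ++ [false]) = p ^ k * (1 - p) := by
  simp [coinP]

theorem concat_mem_coinZ {S : List Bool} (u : List Bool) (b : Bool) :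
    u ++ [b] ∈ coinZ S ↔ S <:+ u ++ [b] ∧ ¬ S <:+: u := by
  simp only [coinZ, Set.mem_ofPred_eq]
  refine and_congr_right fun hS => ?_
  obtain ⟨v, hv⟩ := hS
  have hl : v.length + S.length = u.length + 1 := by simpa using congrArg List.length hv
  have hvm : v.length ∈ (range ((u ++ [b]).length + 1)).filter
      fun i => ((u ++ [b]).drop i).take S.length = S := by
    rw [mem_filter, ← hv]
    simp only [List.length_append, List.drop_left, List.take_length, and_true, mem_range]
    omega
  rw [numOccs, card_eq_one]
  constructor
  · rintro ⟨a, ha⟩ ⟨x, y, hxy⟩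
    have hl' : x.length + S.length + y.length = u.length := by
      simpa [add_assoc] using congrArg List.length hxy
    have hx : x.length ∈ (range ((u ++ [b]).length + 1)).filter
        fun i => ((u ++ [b]).drop i).take S.length = S := by
      rw [mem_filter, ← hxy]
      simp only [List.length_append, mem_range, List.append_assoc, List.drop_left,
        List.take_left, and_true]
      omega
    rw [ha, mem_singleton] at hvm hx
    omega
  · intro hu
    refine ⟨v.length, eq_singleton_iff_unique_mem.2 ⟨hvm, fun i hi => ?_⟩⟩
    have hi := (mem_filter.1 hi)
    have hi1 := mem_range.1 hi.1
    have hi2 := hi.2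
    have hlen := congrArg List.length hi2
    simp only [List.length_take, List.length_drop, List.length_append, List.length_cons,
      List.length_nil] at hlen hi1
    by_contra hne
    have hle : i + S.length ≤ u.length := by omega
    apply hu
    rw [List.drop_append_of_le_length (by omega),
      List.take_append_of_le_length (by simp; omega)] at hi2
    rw [← hi2]
    exact (List.take_prefix _ _).isInfix.trans (List.drop_suffix _ _).isInfix

theorem run_infix_append_replicate (k j : ℕ) (u : List Bool) :
    List.replicate k true ++ [false] <:+: u ++ List.replicate j true ↔
      List.replicate k true ++ [false] <:+: u := by
  induction j with
  | zero => simp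
  | succ j ih =>
    rw [List.replicate_succ', ← List.append_assoc, List.infix_concat_iff, ih]
    refine or_iff_right ?_
    rintro ⟨v, hv⟩
    rw [← List.append_assoc] at hv
    have := (List.append_inj' hv rfl).2
    simp at this

theorem append_run_mem_coinZ (k : ℕ) (u : List Bool) :
    u ++ (List.replicate k true ++ [false]) ∈ coinZ (List.replicate k true ++ [false]) ↔
      ¬ List.replicate k true ++ [false] <:+: u := by
  rw [← List.append_assoc, concat_mem_coinZ, run_infix_append_replicate]
  exact and_iff_right ⟨u, by simp⟩

/-- The probability that `S` does not occur among the first `n` flips. -/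
noncomputable def avoidP (p : ℝ) (S : List Bool) (n : ℕ) : ℝ :=
  ∑ w ∈ binWords n, if S <:+: w then 0 else coinP p w

open Classical in
/-- The probability that `S` occurs for the first time at the `n`-th flip. -/
noncomputable def hitP (p : ℝ) (S : List Bool) (n : ℕ) : ℝ :=
  ∑ w ∈ binWords n, if w ∈ coinZ S then coinP p w else 0

theorem avoidP_nonneg {p : ℝ} (hp : 0 ≤ p) (hp1 : p ≤ 1) (S : List Bool) (n : ℕ) :
    0 ≤ avoidP p S n :=
  sum_nonneg fun w _ => by
    split_ifs
    · exact le_rfl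
    · exact coinP_nonneg hp hp1 w

theorem hitP_nonneg {p : ℝ} (hp : 0 ≤ p) (hp1 : p ≤ 1) (S : List Bool) (n : ℕ) :
    0 ≤ hitP p S n :=
  sum_nonneg fun w _ => by
    split_ifs
    · exact coinP_nonneg hp hp1 w
    · exact le_rfl

theorem avoidP_zero (p : ℝ) {S : List Bool} (hS : S ≠ []) : avoidP p S 0 = 1 := by
  simp [avoidP, binWords, hS, coinP]

theorem hitP_succ (p : ℝ) (S : List Bool) (n : ℕ) :
    hitP p S (n + 1) = avoidP p S n - avoidP p S (n + 1) := by
  classical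
  rw [eq_sub_iff_add_eq, hitP, avoidP, avoidP, ← sum_add_distrib, sum_binWords_succ]
  refine sum_congr rfl fun u _ => ?_
  have key : ∀ b : Bool, ((if u ++ [b] ∈ coinZ S then coinP p (u ++ [b]) else 0) +
      if S <:+: u ++ [b] then 0 else coinP p (u ++ [b])) =
      (if S <:+: u then 0 else coinP p u) * coinP p [b] := by
    intro b
    simp only [concat_mem_coinZ, List.infix_concat_iff, coinP_append]
    by_cases h1 : S <:+: u <;> by_cases h2 : S <:+ u ++ [b] <;> simp [h1, h2]
  rw [key, key, ← mul_add]
  simp [coinP]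

theorem hitP_eq_zero (p : ℝ) {S : List Bool} {n : ℕ} (h : n < S.length) : hitP p S n = 0 := by
  refine sum_eq_zero fun w hw => if_neg fun hZ => ?_
  have := hZ.1.length_le
  rw [mem_binWords.1 hw] at this
  omega

theorem hitP_run_add (p : ℝ) (k n : ℕ) :
    hitP p (List.replicate k true ++ [false]) (n + (k + 1)) =
      p ^ k * (1 - p) * avoidP p (List.replicate k true ++ [false]) n := by
  classical
  rw [mul_comm, avoidP, sum_mul, hitP, ← coinP_run p k]
  set S := List.replicate k true ++ [false] with hS
  have hlen : S.length = k + 1 := by simp [hS]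
  have hinj : Set.InjOn (fun u : List Bool => u ++ S) (binWords n) := by
    intro x _ y _ h
    simpa using h
  have hsub : (binWords n).image (fun u => u ++ S) ⊆ binWords (n + (k + 1)) := by
    intro w hw
    obtain ⟨u, hu, rfl⟩ := mem_image.1 hw
    rw [mem_binWords] at hu ⊢
    simp [hu, hlen]
  rw [← sum_subset hsub, sum_image hinj]
  · refine sum_congr rfl fun u _ => ?_
    rw [hS, append_run_mem_coinZ, ← hS, coinP_append]
    by_cases h : S <:+: u <;> simp [h]
  · intro w hw hw'
    refine if_neg fun hZ => hw' ?_
    obtain ⟨u, rfl⟩ := hZ.1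
    refine mem_image.2 ⟨u, ?_, rfl⟩
    rw [mem_binWords] at hw ⊢
    rw [List.length_append, hlen] at hw
    omega

theorem hasSum_of_hasSum_sum_binWords {f : List Bool → ℝ} (hf : ∀ w, 0 ≤ f w) {a : ℝ}
    (h : HasSum (fun n => ∑ w ∈ binWords n, f w) a) : HasSum f a := by
  have hset : ∀ n, {w : List Bool | w.length = n} = ↑(binWords n) := fun n => by
    ext w
    simp [mem_binWords]
  have hfib : ∀ n, HasSum (fun w : {w : List Bool // w.length = n} => f w)
      (∑ w ∈ binWords n, f w) := fun n => by
    have := (binWords n).hasSum f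
    change HasSum (fun w : ({w : List Bool | w.length = n} : Set _) => f w) _
    rw [hset]
    exact this
  rw [← (Equiv.sigmaFiberEquiv (List.length : List Bool → ℕ)).hasSum_iff]
  refine HasSum.sigma_of_hasSum h hfib ?_
  refine (summable_sigma_of_nonneg fun _ => hf _).2 ⟨fun n => (hfib n).summable, ?_⟩
  convert h.summable using 2 with n
  exact (hfib n).tsum_eq

theorem coinE_eq_of_hasSum {p : ℝ} (hp : 0 ≤ p) (hp1 : p ≤ 1) (S : List Bool) (j : ℕ) {a : ℝ}
    (h : HasSum (fun n : ℕ => (n : ℝ) ^ j * hitP p S n) a) : coinE p S j = a := by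
  classical
  rw [coinE, tsum_subtype (coinZ S) fun w => (w.length : ℝ) ^ j * coinP p w]
  refine (hasSum_of_hasSum_sum_binWords (fun w => ?_) ?_).tsum_eq
  · exact Set.indicator_nonneg
      (fun w _ => mul_nonneg (by positivity) (coinP_nonneg hp hp1 w)) w
  · convert h using 2 with n
    rw [hitP, mul_sum]
    refine sum_congr rfl fun w hw => ?_
    rw [Set.indicator_apply, mem_binWords.1 hw]
    split_ifs <;> simp

theorem avoidP_antitone {p : ℝ} (hp : 0 ≤ p) (hp1 : p ≤ 1) (S : List Bool) :
    Antitone (avoidP p S) :=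
  antitone_nat_of_succ_le fun n => by
    have := hitP_nonneg hp hp1 S (n + 1)
    rw [hitP_succ] at this
    linarith

theorem summable_pow_mul_of_succ_le {a : ℕ → ℝ} {r : ℝ} (k : ℕ) (ha : ∀ n, 0 ≤ a n)
    (hr : 0 ≤ r) (hr1 : r < 1) (h : ∀ n, a (n + k + 1) ≤ r * a (n + k)) (j : ℕ) :
    Summable fun n : ℕ => (n : ℝ) ^ j * a n := by
  have hgeo : ∀ n, a (n + k) ≤ a k * r ^ n := by
    intro n
    induction n with
    | zero => simp
    | succ n ih =>
      calc a (n + 1 + k) = a (n + k + 1) := by rw [add_right_comm]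
        _ ≤ r * a (n + k) := h n
        _ ≤ r * (a k * r ^ n) := by gcongr
        _ = a k * r ^ (n + 1) := by ring
  rw [← summable_nat_add_iff k]
  have hs : Summable fun n : ℕ => ((k : ℝ) + 1) ^ j * a k * (((n : ℝ) + 1) ^ j * r ^ n) := by
    apply Summable.mul_left
    have h0 : Summable fun n : ℕ => (n : ℝ) ^ j * r ^ n :=
      summable_pow_mul_geometric_of_norm_lt_one j (by rwa [Real.norm_of_nonneg hr])
    have h1 := ((summable_nat_add_iff 1).2 h0).mul_left (2 ^ j)
    refine (summable_nat_add_iff 1).1 (Summable.of_nonneg_of_le (fun n => ?_) (fun n => ?_) h1)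
    · positivity
    · have hn : (((n + 1 : ℕ) : ℝ) + 1) ≤ 2 * ((n + 1 : ℕ) : ℝ) := by
        push_cast
        linarith [(n.cast_nonneg : (0 : ℝ) ≤ n)]
      rw [← mul_assoc, ← mul_pow]
      exact mul_le_mul_of_nonneg_right (pow_le_pow_left₀ (by positivity) hn j)
        (pow_nonneg hr _)
  refine Summable.of_nonneg_of_le (fun n => mul_nonneg (by positivity) (ha _)) (fun n => ?_) hs
  calc ((n + k : ℕ) : ℝ) ^ j * a (n + k)
      ≤ (((k : ℝ) + 1) * ((n : ℝ) + 1)) ^ j * (a k * r ^ n) := by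
        gcongr
        · exact ha _
        · push_cast
          have h1 : (0 : ℝ) ≤ n := n.cast_nonneg
          have h2 : (0 : ℝ) ≤ k := k.cast_nonneg
          nlinarith [mul_nonneg h1 h2]
        · exact hgeo n
    _ = _ := by rw [mul_pow]; ring

/-- Summation by parts. -/
theorem hasSum_mul_sub_succ {a g : ℕ → ℝ} {A B : ℝ} (hA : HasSum (fun n => g n * a n) A)
    (hB : HasSum (fun n => g (n + 1) * a n) B) :
    HasSum (fun n => g (n + 1) * (a n - a (n + 1))) (B - (A - g 0 * a 0)) := by
  have h := (hasSum_nat_add_iff' 1).2 hA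
  simp only [range_one, sum_singleton] at h
  simpa only [mul_sub] using hB.sub h

theorem hasSum_pow_mul_hitP_run {p : ℝ} {k j : ℕ} {B : ℝ}
    (hB : HasSum (fun n : ℕ => ((n + 1 : ℕ) : ℝ) ^ j *
      hitP p (List.replicate k true ++ [false]) (n + 1)) B) :
    HasSum (fun n : ℕ => (n : ℝ) ^ j * hitP p (List.replicate k true ++ [false]) n) B ∧
    HasSum (fun n : ℕ => ((n : ℝ) + (k + 1)) ^ j *
      (p ^ k * (1 - p) * avoidP p (List.replicate k true ++ [false]) n)) B := by
  have hz : ∀ n < k + 1, (n : ℝ) ^ j * hitP p (List.replicate k true ++ [false]) n = 0 := by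
    intro n hn
    rw [hitP_eq_zero p (by simpa using hn), mul_zero]
  have h1 : HasSum (fun n : ℕ => (n : ℝ) ^ j *
      hitP p (List.replicate k true ++ [false]) n) B := by
    rw [← hasSum_nat_add_iff' 1]
    simpa only [range_one, sum_singleton, hz 0 (Nat.succ_pos k), sub_zero] using hB
  refine ⟨h1, ?_⟩
  have h2 := (hasSum_nat_add_iff' (k + 1)).2 h1
  rw [sum_eq_zero fun n hn => hz n (mem_range.1 hn), sub_zero] at h2
  simpa only [hitP_run_add, Nat.cast_add, Nat.cast_one] using h2

/-- For `S = H^k T`, `E(Y^2) = 2/((1-p)^2 p^{2k}) - (2k+1)/((1-p) p^k)`. -/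
theorem stmt_10 (p : ℝ) (hp : 0 < p) (hp1 : p < 1) (k : ℕ) (hk : 1 ≤ k) :
    coinE p (List.replicate k true ++ [false]) 2 =
      2 / ((1 - p) ^ 2 * p ^ (2 * k)) - (2 * (k : ℝ) + 1) / ((1 - p) * p ^ k) := by
  set S := List.replicate k true ++ [false] with hS
  set c := p ^ k * (1 - p) with hc
  have hq : 0 < 1 - p := by linarith
  have hc0 : 0 < c := by positivity
  have hc1 : c ≤ 1 := mul_le_one₀ (pow_le_one₀ hp.le hp1.le) hq.le (by linarith)
  have ha0 : avoidP p S 0 = 1 := avoidP_zero p (by simp [hS])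
  have hdecay : ∀ n, avoidP p S (n + k + 1) ≤ (1 - c) * avoidP p S (n + k) := by
    intro n
    have h1 : c * avoidP p S n = avoidP p S (n + k) - avoidP p S (n + k + 1) := by
      rw [← hitP_succ, add_assoc, hS, hitP_run_add]
    have h2 := mul_le_mul_of_nonneg_left
      (avoidP_antitone hp.le hp1.le S (Nat.le_add_right n k)) hc0.le
    linarith
  have hsum := summable_pow_mul_of_succ_le k (avoidP_nonneg hp.le hp1.le S)
    (by linarith) (by linarith) hdecay
  obtain ⟨M0, h0⟩ := hsum 0
  obtain ⟨M1, h1⟩ := hsum 1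
  obtain ⟨M2, h2⟩ := hsum 2
  have moment : ∀ {j : ℕ} {A B : ℝ}, HasSum (fun n : ℕ => (n : ℝ) ^ j * avoidP p S n) A →
      HasSum (fun n : ℕ => ((n + 1 : ℕ) : ℝ) ^ j * avoidP p S n) B →
      HasSum (fun n : ℕ => (n : ℝ) ^ j * hitP p S n) (B - (A - ((0 : ℕ) : ℝ) ^ j)) ∧
      HasSum (fun n : ℕ => ((n : ℝ) + (k + 1)) ^ j * (c * avoidP p S n))
        (B - (A - ((0 : ℕ) : ℝ) ^ j)) := by
    intro j A B hA hB
    have h := hasSum_mul_sub_succ (g := fun n : ℕ => (n : ℝ) ^ j) hA hB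
    rw [ha0, mul_one] at h
    simp only [← hitP_succ] at h
    exact hasSum_pow_mul_hitP_run h
  have e0 : c * M0 = 1 := by
    have h := (moment h0 (by simpa using h0)).2
    have h' := h0.mul_left c
    simp only [pow_zero, one_mul] at h h'
    linarith [h.unique h']
  have e1 : c * (M1 + (k + 1) * M0) = M0 := by
    have hB : HasSum (fun n : ℕ => ((n + 1 : ℕ) : ℝ) ^ 1 * avoidP p S n) (M1 + M0) := by
      convert h1.add h0 using 2 with n
      push_cast
      ring
    have h := (moment h1 hB).2
    have h' : HasSum (fun n : ℕ => ((n : ℝ) + (k + 1)) ^ 1 * (c * avoidP p S n))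
        (c * (M1 + (k + 1) * M0)) := by
      have heq : (fun n : ℕ => ((n : ℝ) + (k + 1)) ^ 1 * (c * avoidP p S n)) = fun n : ℕ =>
          c * ((n : ℝ) ^ 1 * avoidP p S n + (k + 1) * ((n : ℝ) ^ 0 * avoidP p S n)) := by
        funext n
        ring
      rw [heq]
      exact (h1.add (h0.mul_left ((k : ℝ) + 1))).mul_left c
    rw [h'.unique h]
    simp
  have e2 : coinE p S 2 = 2 * M1 + M0 := by
    have hB : HasSum (fun n : ℕ => ((n + 1 : ℕ) : ℝ) ^ 2 * avoidP p S n)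
        (M2 + 2 * M1 + M0) := by
      convert (h2.add (h1.mul_left 2)).add h0 using 2 with n
      push_cast
      ring
    rw [coinE_eq_of_hasSum hp.le hp1.le S 2 (moment h2 hB).1]
    push_cast
    ring
  have m0 : M0 = 1 / c := by rw [eq_div_iff hc0.ne', mul_comm, e0]
  have m1 : M1 = 1 / c ^ 2 - (k + 1) / c := by
    have : c * M1 = M0 - (k + 1) := by linear_combination e1 - ((k : ℝ) + 1) * e0
    rw [m0] at this
    field_simp at this ⊢
    linear_combination this
  have hcc : (1 - p) ^ 2 * p ^ (2 * k) = c ^ 2 := by rw [hc]; ring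
  rw [e2, m0, m1, hcc, mul_comm (1 - p), ← hc]
  field_simp
  ring
end

section
/- Let k ≥ 1, let S = H^k T (a run of k heads followed by one tails), and take p = 1/2. Then for every integer n ≥ 1, E(Y^n) = 2^{k+1} · b_n + ∑_{j=1}^{n−1} C(n, j) · E(Y^j) · ∑_{i=1}^{k} i^{n−j} · 2^{k−i}, where b_n := ∑_{i=0}^{n} e_{n,i} · 2^{n−i} is the n-th ordered Bell number. -/
/-- The classical Eulerian numbers `e_{n,i}`: `e_{0,0} = 1`, `e_{n,i} = 0` whenever
`i ≤ 0` (unless `n = i = 0`) or `i > n`, and otherwise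
`e_{n,i} = i·e_{n-1,i} + (n-i+1)·e_{n-1,i-1}`. -/
def eul : ℕ → ℕ → ℤ
  | 0, 0 => 1
  | 0, _ + 1 => 0
  | _ + 1, 0 => 0
  | n + 1, i + 1 =>
    if i + 1 > n + 1 then 0
    else ((i : ℤ) + 1) * eul n (i + 1) + ((n : ℤ) - i + 1) * eul n i

/-- The `n`-th ordered Bell (Fubini) number `b_n = ∑_{i=0}^n e_{n,i} 2^{n-i}`. -/
def orderedBell (n : ℕ) : ℤ := ∑ i ∈ Finset.range (n + 1), eul n i * 2 ^ (n - i)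

theorem numOccs_nil {S : List Bool} (hS : S ≠ []) : numOccs S [] = 0 := by
  simp [numOccs, hS.symm]

theorem numOccs_cons (S v : List Bool) (b : Bool) :
    numOccs S (b :: v) = numOccs S v + if S <+: b :: v then 1 else 0 := by
  simp only [numOccs, Finset.card_filter, List.length_cons]
  rw [Finset.sum_range_succ']
  simp only [List.drop_succ_cons, List.drop_zero, List.prefix_iff_eq_take, eq_comm (a := S)]

theorem numOccs_concat {S : List Bool} (hS : S ≠ []) (v : List Bool) (b : Bool) :
    numOccs S (v ++ [b]) = numOccs S v + if S <:+ v ++ [b] then 1 else 0 := by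
  induction v with
  | nil =>
    rw [List.nil_append, numOccs_cons, numOccs_nil hS]
    have h : S <+: [b] ↔ S = [b] ∨ S <+: [] := List.prefix_concat_iff (l₂ := [])
    simp only [h, List.suffix_cons_iff, List.prefix_nil, List.suffix_nil]
  | cons a v ih =>
    rw [List.cons_append, numOccs_cons, ih, numOccs_cons, ← List.cons_append]
    have h₁ : S <+: a :: v ++ [b] ↔ S = a :: v ++ [b] ∨ S <+: a :: v := List.prefix_concat_iff
    have h₂ : S <:+ a :: v ++ [b] ↔ S = a :: v ++ [b] ∨ S <:+ v ++ [b] := List.suffix_cons_iff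
    have h₃ : S <+: a :: v → S.length ≤ (a :: v).length := List.IsPrefix.length_le
    have h₄ : S <:+ v ++ [b] → S.length ≤ (v ++ [b]).length := List.IsSuffix.length_le
    simp only [h₁, h₂]
    by_cases h : S = a :: v ++ [b]
    · have h₅ : ¬ S <+: a :: v := fun h' => by have := h₃ h'; simp [h] at this
      have h₆ : ¬ S <:+ v ++ [b] := fun h' => by have := h₄ h'; simp [h] at this
      simp only [h₅, h₆, ite_false, add_zero, or_false]
    · simp only [h, false_or]
      omega

/-- The pattern `H^k T`. -/
abbrev headsTail (k : ℕ) : List Bool := List.replicate k true ++ [false]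

theorem numOccs_append_replicate (k j : ℕ) (v : List Bool) :
    numOccs (headsTail k) (v ++ List.replicate j true) = numOccs (headsTail k) v := by
  induction j with
  | zero => simp
  | succ j ih =>
    rw [List.replicate_succ', ← List.append_assoc, numOccs_concat (by simp), ih, if_neg, add_zero]
    intro h
    rw [List.suffix_concat_iff] at h
    simp at h

theorem numOccs_append_headsTail (k : ℕ) (v : List Bool) :
    numOccs (headsTail k) (v ++ headsTail k) = numOccs (headsTail k) v + 1 := by
  conv_lhs => rw [headsTail, ← List.append_assoc]
  rw [numOccs_concat (by simp), numOccs_append_replicate, if_pos]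
  rw [List.append_assoc]
  exact List.suffix_append _ _

theorem coinP_half (w : List Bool) : coinP (1 / 2) w = (1 / 2) ^ w.length := by
  unfold coinP
  induction w with
  | nil => simp
  | cons b w ih =>
    rw [List.map_cons, List.prod_cons, ih, List.length_cons, pow_succ']
    cases b <;> norm_num

/-- The words of length `m` in which `S` does not occur. -/
def avoiding (S : List Bool) (m : ℕ) : Set (List Bool) := {w | w.length = m ∧ numOccs S w = 0}

theorem finite_avoiding (S : List Bool) (m : ℕ) : (avoiding S m).Finite :=
  (List.finite_length_eq Bool m).subset fun _ h => h.1

/-- The probability that `S` does not occur in `m` fair coin flips. -/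
noncomputable def avoidProb (S : List Bool) (m : ℕ) : ℝ := (avoiding S m).ncard / 2 ^ m

theorem ncard_image_concat (A : Set (List Bool)) (hA : A.Finite) :
    {w | ∃ v ∈ A, ∃ b, w = v ++ [b]}.ncard = 2 * A.ncard := by
  have h : {w | ∃ v ∈ A, ∃ b, w = v ++ [b]} =
      (fun v => v ++ [true]) '' A ∪ (fun v => v ++ [false]) '' A := by
    ext w
    simp only [Bool.exists_bool, Set.mem_ofPred_eq, Set.mem_union, Set.mem_image]
    grind
  rw [h, Set.ncard_union_eq _ (hA.image _) (hA.image _),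
    Set.ncard_image_of_injective _ (List.append_left_injective _),
    Set.ncard_image_of_injective _ (List.append_left_injective _), two_mul]
  rw [Set.disjoint_left]
  rintro _ ⟨v, -, rfl⟩ ⟨u, -, h⟩
  simp at h

theorem exists_mem_avoiding_concat_iff (k m : ℕ) (w : List Bool) :
    (∃ v ∈ avoiding (headsTail k) m, ∃ b, w = v ++ [b]) ↔
      w ∈ avoiding (headsTail k) (m + 1) ∨
        ∃ u, u.length + k = m ∧ numOccs (headsTail k) u = 0 ∧ u ++ headsTail k = w := by
  constructor
  · rintro ⟨v, ⟨hv, h0⟩, b, rfl⟩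
    by_cases h : headsTail k <:+ v ++ [b]
    · right
      obtain ⟨u, hu⟩ := h
      have h1 := numOccs_append_headsTail k u
      have hl := congrArg List.length hu
      simp [hv] at hl
      have h2 := numOccs_concat (S := headsTail k) (by simp) v b
      rw [← hu, h1, h0] at h2
      rw [if_pos (List.suffix_append _ _)] at h2
      exact ⟨u, by omega, by omega, hu⟩
    · left
      refine ⟨by simp [hv], ?_⟩
      rw [numOccs_concat (by simp), h0, if_neg h]
  · rintro (⟨hl, h0⟩ | ⟨u, hl, h0, rfl⟩)
    · obtain rfl | ⟨v, b, rfl⟩ := w.eq_nil_or_concat'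
      · simp at hl
      · rw [numOccs_concat (by simp)] at h0
        exact ⟨v, ⟨by simpa using hl, by omega⟩, b, rfl⟩
    · exact ⟨u ++ List.replicate k true, ⟨by simpa using hl, by
        rw [numOccs_append_replicate, h0]⟩, false, by simp⟩

theorem ncard_avoiding_succ_of_lt {k m : ℕ} (h : m < k) :
    (avoiding (headsTail k) (m + 1)).ncard = 2 * (avoiding (headsTail k) m).ncard := by
  rw [← ncard_image_concat _ (finite_avoiding _ _)]
  congr 1
  ext w
  rw [Set.mem_ofPred_eq, exists_mem_avoiding_concat_iff, or_iff_left]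
  rintro ⟨u, hu, -⟩
  omega

theorem ncard_avoiding_succ_add (k m : ℕ) :
    (avoiding (headsTail k) (m + k + 1)).ncard + (avoiding (headsTail k) m).ncard =
      2 * (avoiding (headsTail k) (m + k)).ncard := by
  rw [← ncard_image_concat _ (finite_avoiding _ _),
    ← Set.ncard_image_of_injective (avoiding (headsTail k) m)
      (List.append_left_injective (headsTail k)),
    ← Set.ncard_union_eq _ (finite_avoiding _ _) ((finite_avoiding _ _).image _)]
  · congr 1
    ext w
    rw [Set.mem_ofPred_eq, exists_mem_avoiding_concat_iff]
    simp [avoiding, and_assoc]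
  · rw [Set.disjoint_left]
    rintro _ ⟨-, h⟩ ⟨u, -, rfl⟩
    rw [numOccs_append_headsTail] at h
    omega

theorem avoidProb_zero (k : ℕ) : avoidProb (headsTail k) 0 = 1 := by
  have h : avoiding (headsTail k) 0 = {[]} := by
    ext w
    simp only [avoiding, Set.mem_ofPred_eq, List.length_eq_zero_iff, Set.mem_singleton_iff,
      and_iff_left_iff_imp]
    rintro rfl
    exact numOccs_nil (by simp)
  simp [avoidProb, h]

theorem avoidProb_nonneg (S : List Bool) (m : ℕ) : 0 ≤ avoidProb S m := by
  unfold avoidProb; positivity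

theorem avoidProb_succ_of_lt {k m : ℕ} (h : m < k) :
    avoidProb (headsTail k) (m + 1) = avoidProb (headsTail k) m := by
  rw [avoidProb, ncard_avoiding_succ_of_lt h, avoidProb, pow_succ']
  push_cast
  rw [mul_div_mul_left _ _ two_ne_zero]

theorem avoidProb_sub_succ (k m : ℕ) :
    avoidProb (headsTail k) (m + k) - avoidProb (headsTail k) (m + k + 1) =
      avoidProb (headsTail k) m / 2 ^ (k + 1) := by
  have h := congrArg (Nat.cast (R := ℝ)) (ncard_avoiding_succ_add k m)
  push_cast at h
  simp only [avoidProb]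
  rw [eq_sub_of_add_eq h]
  field_simp
  ring

theorem antitone_avoidProb (k : ℕ) : Antitone (avoidProb (headsTail k)) := by
  refine antitone_nat_of_succ_le fun m => ?_
  obtain h | h := lt_or_ge m k
  · exact (avoidProb_succ_of_lt h).le
  · obtain ⟨j, rfl⟩ := Nat.exists_eq_add_of_le' h
    have := avoidProb_sub_succ k j
    have : 0 ≤ avoidProb (headsTail k) j / 2 ^ (k + 1) :=
      div_nonneg (avoidProb_nonneg _ _) (by positivity)
    linarith

theorem avoidProb_add_le (k m : ℕ) :
    avoidProb (headsTail k) (m + k) ≤ (1 - 1 / 2 ^ (k + 1)) ^ m := by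
  have hε : (1 : ℝ) / 2 ^ (k + 1) ≤ 1 := by
    rw [div_le_one (by positivity)]; exact one_le_pow₀ one_le_two
  induction m with
  | zero => simpa [avoidProb_zero] using antitone_avoidProb k (Nat.zero_le (0 + k))
  | succ m ih =>
    have h₁ := avoidProb_sub_succ k m
    have h₂ := antitone_avoidProb k (Nat.le_add_right m k)
    have h₃ : avoidProb (headsTail k) (m + k) / 2 ^ (k + 1) ≤
        avoidProb (headsTail k) m / 2 ^ (k + 1) := by gcongr
    calc avoidProb (headsTail k) (m + 1 + k) = avoidProb (headsTail k) (m + k + 1) := by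
          rw [add_right_comm]
      _ ≤ (1 - 1 / 2 ^ (k + 1)) * avoidProb (headsTail k) (m + k) := by
          rw [sub_mul, one_mul, one_div_mul_eq_div]
          linarith
      _ ≤ _ := by
          rw [pow_succ' _ m]
          exact mul_le_mul_of_nonneg_left ih (sub_nonneg.2 hε)

/-- Appending `H^k T` to the words avoiding it gives the words in which it occurs exactly once,
at the end. -/
noncomputable def sigmaAvoidingEquivCoinZ (k : ℕ) :
    (Σ m, avoiding (headsTail k) m) ≃ coinZ (headsTail k) :=
  Equiv.ofBijective
    (fun x => ⟨x.2.1 ++ headsTail k, List.suffix_append _ _, by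
      rw [numOccs_append_headsTail, x.2.2.2]⟩) <| by
    constructor
    · rintro ⟨m, v, hv, hv'⟩ ⟨m', v', hw, hw'⟩ h
      obtain rfl : v = v' := List.append_cancel_right (congrArg Subtype.val h)
      obtain rfl := hv.symm.trans hw
      rfl
    · rintro ⟨w, ⟨u, rfl⟩, h⟩
      rw [numOccs_append_headsTail] at h
      exact ⟨⟨u.length, u, rfl, by omega⟩, rfl⟩

theorem sigmaAvoidingEquivCoinZ_apply (k : ℕ) (x : Σ m, avoiding (headsTail k) m) :
    (sigmaAvoidingEquivCoinZ k x).1 = x.2.1 ++ headsTail k :=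
  rfl

/-- The moments of the waiting time for `H^k T`, in terms of the probabilities of avoiding
`H^k T`. -/
theorem coinE_headsTail (k n : ℕ)
    (hs : Summable fun m : ℕ => avoidProb (headsTail k) m * ((m : ℝ) + (k + 1)) ^ n) :
    coinE (1 / 2) (headsTail k) n =
      (∑' m : ℕ, avoidProb (headsTail k) m * ((m : ℝ) + (k + 1)) ^ n) / 2 ^ (k + 1) := by
  rw [coinE, ← (sigmaAvoidingEquivCoinZ k).tsum_eq]
  have hterm (x : Σ m, avoiding (headsTail k) m) :
      ((sigmaAvoidingEquivCoinZ k x).1.length : ℝ) ^ n *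
        coinP (1 / 2) (sigmaAvoidingEquivCoinZ k x).1 =
      ((x.1 : ℝ) + (k + 1)) ^ n * (1 / 2) ^ (x.1 + (k + 1)) := by
    have : (sigmaAvoidingEquivCoinZ k x).1.length = x.1 + (k + 1) := by
      simp [sigmaAvoidingEquivCoinZ_apply, x.2.2.1]
    rw [coinP_half, this]
    push_cast
    rfl
  have hfiber (m : ℕ) :
      ∑' _ : avoiding (headsTail k) m, ((m : ℝ) + (k + 1)) ^ n * (1 / 2) ^ (m + (k + 1)) =
        avoidProb (headsTail k) m * ((m : ℝ) + (k + 1)) ^ n / 2 ^ (k + 1) := by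
    rw [tsum_const, Nat.card_coe_set_eq, nsmul_eq_mul, avoidProb, pow_add, one_div, inv_pow, inv_pow]
    field_simp
  simp only [hterm]
  have hsig : Summable fun x : Σ m, avoiding (headsTail k) m =>
      ((x.1 : ℝ) + (k + 1)) ^ n * (1 / 2 : ℝ) ^ (x.1 + (k + 1)) := by
    rw [summable_sigma_of_nonneg fun x => by positivity]
    refine ⟨fun m => ?_, ?_⟩
    · have := (finite_avoiding (headsTail k) m).to_subtype
      exact Summable.of_finite
    · simp only [hfiber]
      exact hs.div_const _
  rw [hsig.tsum_sigma]
  simp only [hfiber]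
  exact tsum_div_const

open Polynomial

theorem eul_of_lt {n i : ℕ} (h : n < i) : eul n i = 0 := by
  obtain _ | n := n <;> obtain _ | i := i <;> simp_all [eul]

theorem eul_succ_succ (n i : ℕ) :
    eul (n + 1) (i + 1) = (i + 1) * eul n (i + 1) + (n - i + 1) * eul n i := by
  rw [eul]
  split_ifs with h
  · rw [eul_of_lt (by omega), eul_of_lt (by omega)]; simp
  · rfl

theorem mul_choose_eq_add {m n i : ℕ} (h : i ≤ n) :
    (m : ℤ) * (m + n - i).choose n =
      i * (m + n + 1 - i).choose (n + 1) + (n + 1 - i) * (m + n - i).choose (n + 1) := by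
  have h₁ := congrArg (Nat.cast (R := ℤ)) (Nat.choose_succ_right_eq (m + n - i) n)
  obtain ⟨N, hN⟩ : ∃ N, m + n - i = N := ⟨_, rfl⟩
  have hN' : m + n + 1 - i = N + 1 := by omega
  have hm : (m : ℤ) = N - n + i := by omega
  rw [hN', Nat.choose_succ_succ, hN, hm]
  rw [hN] at h₁
  push_cast at h₁ ⊢
  obtain h | h := le_or_gt n N
  · push_cast [h] at h₁
    linear_combination -h₁
  · simp [Nat.choose_eq_zero_of_lt h, Nat.choose_eq_zero_of_lt (h.trans n.lt_succ_self)]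

/-- **Worpitzky's identity**. -/
theorem pow_eq_sum_eul_mul_choose (m n : ℕ) :
    (m : ℤ) ^ n = ∑ i ∈ Finset.range (n + 1), eul n i * (m + n - i).choose n := by
  induction n with
  | zero => simp [eul]
  | succ n ih =>
    rw [pow_succ', ih, Finset.mul_sum]
    have h (i) (hi : i ∈ Finset.range (n + 1)) :
        (m : ℤ) * (eul n i * (m + n - i).choose n) =
          i * eul n i * (m + n + 1 - i).choose (n + 1) +
            (n - i + 1) * eul n i * (m + n - i).choose (n + 1) := by
      linear_combination eul n i * mul_choose_eq_add (m := m) (Finset.mem_range_succ_iff.1 hi)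
    rw [Finset.sum_congr rfl h, Finset.sum_add_distrib, Finset.sum_range_succ' _ (n + 1)]
    have h₁ : ∑ i ∈ Finset.range (n + 1), (i : ℤ) * eul n i * (m + n + 1 - i).choose (n + 1) =
        ∑ i ∈ Finset.range (n + 1), (i + 1 : ℤ) * eul n (i + 1) * (m + n - i).choose (n + 1) := by
      rw [Finset.sum_range_succ', Finset.sum_range_succ _ n, eul_of_lt n.lt_succ_self]
      simp only [Nat.cast_zero, zero_mul, mul_zero, add_zero]
      refine Finset.sum_congr rfl fun i _ => ?_
      rw [show m + n + 1 - (i + 1) = m + n - i by omega]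
      push_cast
      ring
    rw [h₁, ← Finset.sum_add_distrib]
    simp only [eul_succ_succ, show ∀ i, m + (n + 1) - (i + 1) = m + n - i by omega]
    rw [show eul (n + 1) 0 = 0 from rfl, zero_mul, add_zero]
    exact Finset.sum_congr rfl fun i _ => by ring

theorem hasSum_choose_sub_mul_geometric {n i : ℕ} (h : i ≤ n) :
    HasSum (fun m : ℕ => ((m + n - i).choose n : ℝ) * (1 / 2) ^ (m + 1)) (2 ^ (n - i)) := by
  have h₁ := hasSum_choose_mul_geometric_of_norm_lt_one n (r := (1 / 2 : ℝ)) (by norm_num)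
  rw [← hasSum_nat_add_iff' i]
  rw [Finset.sum_eq_zero, sub_zero]
  · have hf : (fun j : ℕ => ((j + i + n - i).choose n : ℝ) * (1 / 2) ^ (j + i + 1)) =
        fun j => ((j + n).choose n : ℝ) * (1 / 2) ^ j * (1 / 2) ^ (i + 1) := by
      ext j
      rw [show j + i + n - i = j + n by omega]
      ring
    have ha : (2 : ℝ) ^ (n - i) = 1 / (1 - 1 / 2) ^ (n + 1) * (1 / 2) ^ (i + 1) := by
      obtain ⟨j, rfl⟩ := Nat.exists_eq_add_of_le h
      rw [Nat.add_sub_cancel_left]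
      norm_num [pow_add]
      field_simp
      rw [← mul_pow]
      norm_num
    rw [hf, ha]
    exact h₁.mul_right _
  · intro m hm
    rw [Finset.mem_range] at hm
    rw [Nat.choose_eq_zero_of_lt (by omega)]
    simp

theorem hasSum_orderedBell (n : ℕ) :
    HasSum (fun m : ℕ => (1 / 2 : ℝ) ^ (m + 1) * (m : ℝ) ^ n) (orderedBell n) := by
  have h := hasSum_sum (s := Finset.range (n + 1)) fun i hi =>
    (hasSum_choose_sub_mul_geometric (Finset.mem_range_succ_iff.1 hi)).mul_left (eul n i : ℝ)
  have hf : (fun m : ℕ => (1 / 2 : ℝ) ^ (m + 1) * (m : ℝ) ^ n) = fun m : ℕ =>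
      ∑ i ∈ Finset.range (n + 1), (eul n i : ℝ) * ((m + n - i).choose n * (1 / 2) ^ (m + 1)) := by
    ext m
    have := congrArg (Int.cast (R := ℝ)) (pow_eq_sum_eul_mul_choose m n)
    push_cast at this
    rw [this, Finset.mul_sum]
    exact Finset.sum_congr rfl fun i _ => by ring
  have ha : (orderedBell n : ℝ) = ∑ i ∈ Finset.range (n + 1), (eul n i : ℝ) * 2 ^ (n - i) := by
    simp [orderedBell]
  rwa [hf, ha]

theorem summable_mul_eval {c : ℕ → ℝ} (hc : ∀ n : ℕ, Summable fun m : ℕ => c m * (m : ℝ) ^ n)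
    (f : ℝ[X]) : Summable fun m : ℕ => c m * f.eval (m : ℝ) := by
  simp only [eval_eq_sum_range, Finset.mul_sum]
  refine summable_sum fun i _ => ?_
  simpa only [mul_left_comm] using (hc i).mul_left (f.coeff i)

/-- The linear functional `f ↦ ∑ c m * f(m)` on polynomials, for weights `c` with finite
moments. -/
noncomputable def weightedSum (c : ℕ → ℝ)
    (hc : ∀ f : ℝ[X], Summable fun m : ℕ => c m * f.eval (m : ℝ)) : ℝ[X] →ₗ[ℝ] ℝ where
  toFun f := ∑' m : ℕ, c m * f.eval (m : ℝ)
  map_add' f g := by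
    simp only [eval_add, mul_add]
    exact (hc f).tsum_add (hc g)
  map_smul' r f := by
    simp only [eval_smul, smul_eq_mul, RingHom.id_apply, ← tsum_mul_left, mul_left_comm]

theorem two_mul_weightedSum_geometric (hc) (f : ℝ[X]) :
    2 * weightedSum (fun m => (1 / 2) ^ (m + 1)) hc f -
      weightedSum (fun m => (1 / 2) ^ (m + 1)) hc (taylor 1 f) = f.eval 0 := by
  have h := (hc f).tsum_eq_zero_add
  simp only [weightedSum, LinearMap.coe_mk, AddHom.coe_mk, taylor_eval]
  have h₁ (m : ℕ) : 2 * ((1 / 2 : ℝ) ^ (m + 1 + 1) * f.eval ((m + 1 : ℕ) : ℝ)) =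
      (1 / 2) ^ (m + 1) * f.eval ((m : ℝ) + 1) := by
    push_cast
    ring
  rw [h, mul_add, ← tsum_mul_left]
  simp only [h₁]
  simp

/-- A linear functional on polynomials that is invariant under forward differences vanishes. -/
theorem eq_zero_of_forall_apply_eq_apply_taylor_sub {Φ : ℝ[X] →ₗ[ℝ] ℝ}
    (h : ∀ f, Φ f = Φ (taylor 1 f - f)) : Φ = 0 := by
  suffices H : ∀ (d : WithBot ℕ) (f : ℝ[X]), f.degree = d → Φ f = 0 from
    LinearMap.ext fun f => H _ f rfl
  intro d
  induction d using WellFoundedLT.induction with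
  | ind d ih =>
    rintro f rfl
    obtain rfl | hf := eq_or_ne f 0
    · exact map_zero Φ
    rw [h]
    refine ih _ ?_ _ rfl
    rw [← degree_taylor f 1]
    exact degree_sub_lt_left (degree_taylor f 1) (by simpa using hf) (leadingCoeff_taylor 1 f)

/-- The operator `2 ^ k - ∑ 2 ^ (k - i) τ ^ i`, where `τ` is the unit shift. -/
noncomputable def shiftOperator (k : ℕ) : ℝ[X] →ₗ[ℝ] ℝ[X] :=
  (2 : ℝ) ^ k • LinearMap.id - ∑ i ∈ Finset.Icc 1 k, (2 : ℝ) ^ (k - i) • taylor (i : ℝ)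

theorem shiftOperator_apply (k : ℕ) (f : ℝ[X]) : shiftOperator k f =
    (2 : ℝ) ^ k • f - ∑ i ∈ Finset.Icc 1 k, (2 : ℝ) ^ (k - i) • taylor (i : ℝ) f := by
  simp [shiftOperator]

theorem shiftOperator_succ_apply (k : ℕ) (f : ℝ[X]) :
    shiftOperator (k + 1) f = (2 : ℝ) • shiftOperator k f - taylor (k + 1 : ℝ) f := by
  rw [shiftOperator_apply, shiftOperator_apply, Finset.sum_Icc_succ_top (by omega), smul_sub,
    Finset.smul_sum, smul_smul, pow_succ', sub_sub, Nat.sub_self, pow_zero, one_smul]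
  congr 2
  · refine Finset.sum_congr rfl fun i hi => ?_
    rw [smul_smul, ← pow_succ', Nat.succ_sub (Finset.mem_Icc.1 hi).2]
  · push_cast; rfl

theorem shiftOperator_two_smul_sub_taylor (k : ℕ) (f : ℝ[X]) :
    shiftOperator k ((2 : ℝ) • f - taylor 1 f) =
      taylor (k + 1 : ℝ) f - (2 : ℝ) ^ (k + 1) • (taylor 1 f - f) := by
  induction k with
  | zero =>
    simp [shiftOperator_apply]
    module
  | succ k ih =>
    rw [shiftOperator_succ_apply, ih, map_sub, map_smul, taylor_taylor]
    push_cast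
    module

theorem summable_avoidProb_mul_eval (k : ℕ) (f : ℝ[X]) :
    Summable fun m : ℕ => avoidProb (headsTail k) m * f.eval (m : ℝ) := by
  refine summable_mul_eval (fun n => ?_) f
  rw [← summable_nat_add_iff k]
  set r : ℝ := 1 - 1 / 2 ^ (k + 1) with hr
  have hr₁ : ‖r‖ < 1 := by
    have h₁ : (0 : ℝ) < 1 / 2 ^ (k + 1) := by positivity
    have h₂ : (1 : ℝ) / 2 ^ (k + 1) ≤ 1 := by
      rw [div_le_one (by positivity)]; exact one_le_pow₀ one_le_two
    rw [Real.norm_eq_abs, abs_lt]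
    constructor <;> linarith
  have h := summable_mul_eval (c := fun m => r ^ m)
    (fun n => by simpa only [mul_comm] using summable_pow_mul_geometric_of_norm_lt_one n hr₁)
    (taylor (k : ℝ) (X ^ n))
  simp only [taylor_eval, eval_pow, eval_X] at h
  refine h.of_nonneg_of_le (fun m => ?_) fun m => ?_
  · exact mul_nonneg (avoidProb_nonneg _ _) (by positivity)
  · push_cast
    exact mul_le_mul_of_nonneg_right (avoidProb_add_le k m) (by positivity)

/-- The expectation of a polynomial in the waiting time for `H^k T`. -/
noncomputable def polyExpectation (k : ℕ) : ℝ[X] →ₗ[ℝ] ℝ :=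
  (1 / 2 ^ (k + 1) : ℝ) •
    weightedSum (avoidProb (headsTail k)) (summable_avoidProb_mul_eval k) ∘ₗ taylor (k + 1 : ℝ)

theorem polyExpectation_apply (k : ℕ) (f : ℝ[X]) : polyExpectation k f =
    (∑' m : ℕ, avoidProb (headsTail k) m * f.eval ((m : ℝ) + (k + 1))) / 2 ^ (k + 1) := by
  simp only [polyExpectation, weightedSum, LinearMap.smul_apply, LinearMap.comp_apply,
    LinearMap.coe_mk, AddHom.coe_mk, taylor_eval, smul_eq_mul, one_div_mul_eq_div]

theorem polyExpectation_X_pow (k n : ℕ) :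
    polyExpectation k (X ^ n) = coinE (1 / 2) (headsTail k) n := by
  have hs := summable_avoidProb_mul_eval k (taylor (k + 1 : ℝ) (X ^ n))
  simp only [taylor_eval, eval_pow, eval_X] at hs
  rw [coinE_headsTail k n hs, polyExpectation_apply]
  simp only [eval_pow, eval_X]

/-- Summation by parts. -/
theorem polyExpectation_eq_eval_zero_add (k : ℕ) (f : ℝ[X]) :
    polyExpectation k f = f.eval 0 +
      weightedSum (avoidProb (headsTail k)) (summable_avoidProb_mul_eval k) (taylor 1 f - f) := by
  have hs₀ := summable_avoidProb_mul_eval k f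
  have hs₁ := summable_avoidProb_mul_eval k (taylor 1 f)
  have hs₂ := (summable_nat_add_iff 1).2 hs₀
  have h₀ := hs₀.tsum_eq_zero_add
  rw [polyExpectation_apply, map_sub]
  simp only [weightedSum, LinearMap.coe_mk, AddHom.coe_mk, taylor_eval] at hs₁ ⊢
  simp only [Nat.cast_add, Nat.cast_one] at hs₂ h₀
  have hd := (hs₁.sub hs₂).sum_add_tsum_nat_add k
  rw [hs₁.tsum_sub hs₂, Finset.sum_eq_zero, zero_add] at hd
  · have hterm (m : ℕ) : avoidProb (headsTail k) (m + k) * f.eval (((m + k : ℕ) : ℝ) + 1) -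
        avoidProb (headsTail k) (m + k + 1) * f.eval (((m + k : ℕ) : ℝ) + 1) =
        avoidProb (headsTail k) m * f.eval ((m : ℝ) + (k + 1)) / 2 ^ (k + 1) := by
      rw [← sub_mul, avoidProb_sub_succ]
      push_cast
      rw [add_assoc]
      ring
    simp only [hterm, tsum_div_const] at hd
    rw [hd, h₀, avoidProb_zero, Nat.cast_zero]
    ring
  · intro m hm
    rw [avoidProb_succ_of_lt (Finset.mem_range.1 hm), sub_self]

theorem polyExpectation_one (k : ℕ) : polyExpectation k 1 = 1 := by
  rw [polyExpectation_eq_eval_zero_add]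
  simp

theorem polyExpectation_taylor (k : ℕ) (f : ℝ[X]) :
    polyExpectation k (taylor (k + 1 : ℝ) f) =
      f.eval (k + 1 : ℝ) + 2 ^ (k + 1) * polyExpectation k (taylor 1 f - f) := by
  rw [polyExpectation_eq_eval_zero_add, taylor_eval, zero_add, taylor_taylor, add_comm (1 : ℝ),
    ← taylor_taylor, ← map_sub]
  congr 1
  simp [polyExpectation]

theorem polyExpectation_shiftOperator (k : ℕ) (f : ℝ[X]) (hc) :
    polyExpectation k (shiftOperator k f) - (shiftOperator k f).eval 0 =
      2 ^ (k + 1) * (weightedSum (fun m => (1 / 2) ^ (m + 1)) hc f - f.eval 0) := by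
  let ev : ℝ[X] →ₗ[ℝ] ℝ := leval 0
  have hev (g) : ev g = g.eval 0 := rfl
  have key := eq_zero_of_forall_apply_eq_apply_taylor_sub
    (Φ := (polyExpectation k - ev) ∘ₗ shiftOperator k -
      (2 : ℝ) ^ (k + 1) • (weightedSum (fun m => (1 / 2) ^ (m + 1)) hc - ev)) fun g => by
    rw [← sub_eq_zero, ← map_sub, show g - (taylor 1 g - g) = (2 : ℝ) • g - taylor 1 g by module]
    have hB := two_mul_weightedSum_geometric hc g
    have hE := polyExpectation_taylor k g
    simp only [LinearMap.sub_apply, LinearMap.comp_apply, LinearMap.smul_apply,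
      shiftOperator_two_smul_sub_taylor]
    simp only [map_sub, map_smul, hev, eval_sub, eval_smul, taylor_eval, smul_eq_mul,
      zero_add] at hE ⊢
    linear_combination hE - 2 ^ (k + 1) * hB
  have h := LinearMap.congr_fun key f
  simp only [LinearMap.sub_apply, LinearMap.comp_apply, LinearMap.smul_apply, smul_eq_mul,
    LinearMap.zero_apply, hev] at h
  linarith

theorem sum_Icc_two_pow_sub (k : ℕ) : ∑ i ∈ Finset.Icc 1 k, (2 : ℝ) ^ (k - i) = 2 ^ k - 1 := by
  induction k with
  | zero => simp
  | succ k ih =>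
    rw [Finset.sum_Icc_succ_top (by omega), Nat.sub_self, pow_zero, pow_succ]
    have h (i) (hi : i ∈ Finset.Icc 1 k) : (2 : ℝ) ^ (k + 1 - i) = 2 ^ (k - i) * 2 := by
      rw [← pow_succ, Nat.succ_sub (Finset.mem_Icc.1 hi).2]
    rw [Finset.sum_congr rfl h, ← Finset.sum_mul, ih]
    ring

theorem polyExpectation_taylor_X_pow (k : ℕ) {n : ℕ} (hn : 1 ≤ n) (r : ℝ) :
    polyExpectation k (taylor r (X ^ n)) = coinE (1 / 2) (headsTail k) n + r ^ n +
      ∑ j ∈ Finset.Icc 1 (n - 1), n.choose j * coinE (1 / 2) (headsTail k) j * r ^ (n - j) := by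
  obtain ⟨n, rfl⟩ := Nat.exists_eq_add_of_le' hn
  have h (j : ℕ) : (X : ℝ[X]) ^ j * C r ^ (n + 1 - j) * ((n + 1).choose j : ℝ[X]) =
      ((n + 1).choose j * r ^ (n + 1 - j) : ℝ) • X ^ j := by
    rw [smul_eq_C_mul]
    simp only [map_mul, map_pow, map_natCast]
    ring
  rw [taylor_X_pow, add_pow, map_sum, Finset.sum_range_succ, Finset.sum_range_succ',
    Nat.add_sub_cancel, Finset.range_eq_Ico,
    Finset.sum_Ico_add' (fun j => polyExpectation k
      (X ^ j * C r ^ (n + 1 - j) * ((n + 1).choose j : ℝ[X]))) 0 n 1]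
  simp only [h, map_smul, smul_eq_mul, polyExpectation_X_pow]
  rw [← polyExpectation_X_pow k 0, pow_zero, polyExpectation_one, zero_add,
    show Finset.Ico 1 (n + 1) = Finset.Icc 1 n by ext; simp]
  have hsum : ∑ j ∈ Finset.Icc 1 n,
      ((n + 1).choose j * r ^ (n + 1 - j) : ℝ) * coinE (1 / 2) (headsTail k) j =
      ∑ j ∈ Finset.Icc 1 n,
        (n + 1).choose j * coinE (1 / 2) (headsTail k) j * r ^ (n + 1 - j) :=
    Finset.sum_congr rfl fun j _ => by ring
  rw [hsum]
  simp
  ring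

/-- For `S = H^k T` and `p = 1/2`:
`E(Y^n) = 2^{k+1} b_n + ∑_{j=1}^{n-1} C(n,j) E(Y^j) ∑_{i=1}^k i^{n-j} 2^{k-i}`. -/
theorem stmt_11 (k : ℕ) (hk : 1 ≤ k) (n : ℕ) (hn : 1 ≤ n) :
    coinE (1 / 2) (List.replicate k true ++ [false]) n =
      2 ^ (k + 1) * (orderedBell n : ℝ) +
        ∑ j ∈ Finset.Icc 1 (n - 1),
          (n.choose j : ℝ) * coinE (1 / 2) (List.replicate k true ++ [false]) j *
            ∑ i ∈ Finset.Icc 1 k, (i : ℝ) ^ (n - j) * 2 ^ (k - i) := by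
  have hc (f : ℝ[X]) : Summable fun m : ℕ => (1 / 2 : ℝ) ^ (m + 1) * f.eval (m : ℝ) :=
    summable_mul_eval (fun n => (hasSum_orderedBell n).summable) f
  have h := polyExpectation_shiftOperator k (X ^ n) hc
  have hB : weightedSum (fun m => (1 / 2) ^ (m + 1)) hc (X ^ n) = orderedBell n := by
    simpa [weightedSum] using (hasSum_orderedBell n).tsum_eq
  have hn0 : (0 : ℝ) ^ n = 0 := zero_pow (by omega)
  rw [hB] at h
  simp only [shiftOperator_apply, map_sub, map_sum, map_smul, smul_eq_mul, eval_sub, eval_smul,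
    eval_finsetSum, taylor_eval, zero_add, eval_pow, eval_X, hn0, polyExpectation_X_pow,
    polyExpectation_taylor_X_pow k hn, mul_add, Finset.sum_add_distrib, ← Finset.sum_mul,
    sum_Icc_two_pow_sub] at h
  have hsum : ∑ i ∈ Finset.Icc 1 k, (2 : ℝ) ^ (k - i) * ∑ j ∈ Finset.Icc 1 (n - 1),
      n.choose j * coinE (1 / 2) (headsTail k) j * (i : ℝ) ^ (n - j) =
      ∑ j ∈ Finset.Icc 1 (n - 1), (n.choose j : ℝ) * coinE (1 / 2) (headsTail k) j *
        ∑ i ∈ Finset.Icc 1 k, (i : ℝ) ^ (n - j) * 2 ^ (k - i) := by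
    simp only [Finset.mul_sum]
    rw [Finset.sum_comm]
    exact Finset.sum_congr rfl fun j _ => Finset.sum_congr rfl fun i _ => by ring
  rw [hsum] at h
  linarith
end
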